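/- arXiv:2003.10235 — 5 statements merged into one kernel-verified Lean document; each statement's English description precedes it below -/
import Mathlib

section
/- Let (X,d) be a complete metric space, let x₀ ∈ X be a fixed base point and write ‖x‖ := d(x,x₀) for x ∈ X. Let f : X → X, let ψ : [0,∞) → [0,∞) be increasing, continuous at 0 with ψ(0) = 0, and let Λ ≥ 0, α ≥ 1 and β ∈ [0,α] be fixed constants. If for every ε ∈ [0,1] and all x,y ∈ X one has d(f(x),f(y)) ≤ (1-ε)·d(x,y) + Λ·ε^α·ψ(ε)·(1 + ‖x‖ + ‖y‖)^β, then f possesses a unique fixed point x* = f(x*), and moreover there exists a constant C with 0 ≤ C ≤ Λ·(1 + 4‖x*‖)^β such that d(x*, fⁿ(x₀)) ≤ C·(α/n)^α·∑_{k=1}^{n} ψ(α/k) for every n ≥ 1. -/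
open Filter Topology

/-- A real sequence that contracts by `1 - ε` up to an error `K * ε ^ α * ψ ε`, for every
`ε ∈ [0, 1]`, is at most `K * (α / n) ^ α * ∑ k ∈ Icc 1 n, ψ (α / k)` from index `1` on. -/
theorem le_mul_sum_of_contraction_error {ψ : ℝ → ℝ} (hψ_nonneg : ∀ t, 0 ≤ t → 0 ≤ ψ t)
    (hψ_mono : MonotoneOn ψ (Set.Ici 0)) {α K : ℝ} (hα : 1 ≤ α) (hK : 0 ≤ K) {a : ℕ → ℝ}
    (h : ∀ ε ∈ Set.Icc (0 : ℝ) 1, ∀ n, a (n + 1) ≤ (1 - ε) * a n + K * ε ^ α * ψ ε)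
    {n : ℕ} (hn : 1 ≤ n) :
    a n ≤ K * (α / n) ^ α * ∑ k ∈ Finset.Icc 1 n, ψ (α / k) := by
  have hα0 : 0 < α := by linarith
  have scaled : ∀ n : ℕ, (n : ℝ) ^ α * a n ≤ K * α ^ α * ∑ k ∈ Finset.Icc 1 n, ψ (α / k) := by
    intro n
    induction n with
    | zero => simp [Real.zero_rpow hα0.ne']
    | succ n ih =>
      rw [Finset.sum_Icc_succ_top (by omega), mul_add]
      have hp : (0 : ℝ) < ((n + 1 : ℕ) : ℝ) := by positivity
      have hpα : (0 : ℝ) < ((n + 1 : ℕ) : ℝ) ^ α := by positivity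
      have hq : (0 : ℝ) ≤ (n : ℝ) / (n + 1 : ℕ) := by positivity
      have hq1 : (n : ℝ) / (n + 1 : ℕ) ≤ 1 := by
        rw [div_le_one hp]; push_cast; linarith
      set ε : ℝ := 1 - ((n : ℝ) / (n + 1 : ℕ)) ^ α with hε
      have hε0 : 0 ≤ ε := sub_nonneg.2 (Real.rpow_le_one hq hq1 hα0.le)
      have hε1 : ε ≤ 1 := sub_le_self _ (Real.rpow_nonneg hq α)
      have bernoulli : ε ≤ α / (n + 1 : ℕ) := by
        have hb := one_add_mul_self_le_rpow_one_add
          (s := (n : ℝ) / (n + 1 : ℕ) - 1) (by linarith) hα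
        have hs : (n : ℝ) / (n + 1 : ℕ) - 1 = -(1 / (n + 1 : ℕ)) := by
          field_simp; push_cast; ring
        rw [add_sub_cancel, hs] at hb
        rw [hε, div_eq_mul_one_div α]
        linarith
      have hψε : ψ ε ≤ ψ (α / (n + 1 : ℕ)) :=
        hψ_mono hε0 (hε0.trans bernoulli) bernoulli
      have hpow : ε ^ α ≤ (α / (n + 1 : ℕ)) ^ α := Real.rpow_le_rpow hε0 bernoulli hα0.le
      have hmul : K * ε ^ α * ψ ε ≤ K * (α / (n + 1 : ℕ)) ^ α * ψ (α / (n + 1 : ℕ)) := by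
        have := hψ_nonneg ε hε0
        gcongr
      calc ((n + 1 : ℕ) : ℝ) ^ α * a (n + 1)
          ≤ ((n + 1 : ℕ) : ℝ) ^ α *
            ((1 - ε) * a n + K * (α / (n + 1 : ℕ)) ^ α * ψ (α / (n + 1 : ℕ))) := by
            gcongr
            linarith [h ε ⟨hε0, hε1⟩ n]
        _ = (n : ℝ) ^ α * a n + K * α ^ α * ψ (α / (n + 1 : ℕ)) := by
            rw [hε, sub_sub_cancel, Real.div_rpow (by positivity) hp.le,
              Real.div_rpow hα0.le hp.le]
            field_simp
        _ ≤ _ := by linarith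
  have hp : (0 : ℝ) < n := by exact_mod_cast hn
  have hpα : (0 : ℝ) < (n : ℝ) ^ α := by positivity
  rw [Real.div_rpow hα0.le hp.le, mul_div_assoc', div_mul_eq_mul_div, le_div_iff₀ hpα, mul_comm]
  exact scaled n

theorem tendsto_rpow_mul_sum {ψ : ℝ → ℝ} (hψ_nonneg : ∀ t, 0 ≤ t → 0 ≤ ψ t)
    (hψ_cont : ContinuousWithinAt ψ (Set.Ici 0) 0) (hψ0 : ψ 0 = 0) {α : ℝ} (hα : 1 ≤ α) (K : ℝ) :
    Tendsto (fun n : ℕ => K * (α / n) ^ α * ∑ k ∈ Finset.Icc 1 n, ψ (α / k)) atTop (𝓝 0) := by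
  have hα0 : 0 ≤ α := by linarith
  have hu : Tendsto (fun k : ℕ => ψ (α / (k + 1 : ℕ))) atTop (𝓝 0) := by
    have h1 : Tendsto (fun k : ℕ => α / ((k + 1 : ℕ) : ℝ)) atTop (𝓝[Set.Ici 0] 0) :=
      tendsto_nhdsWithin_iff.2
        ⟨(tendsto_const_div_atTop_nhds_zero_nat α).comp (tendsto_add_atTop_nat 1),
          Eventually.of_forall fun k => div_nonneg hα0 (Nat.cast_nonneg _)⟩
    have h2 : Tendsto ψ (𝓝[Set.Ici 0] 0) (𝓝 0) := by
      simpa only [ContinuousWithinAt, hψ0] using hψ_cont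
    exact h2.comp h1
  have hbound : Tendsto (fun n : ℕ =>
      α ^ α * ((n : ℝ)⁻¹ * ∑ k ∈ Finset.range n, ψ (α / (k + 1 : ℕ)))) atTop (𝓝 0) := by
    simpa using hu.cesaro.const_mul (α ^ α)
  have hmain : Tendsto (fun n : ℕ => (α / n) ^ α * ∑ k ∈ Finset.Icc 1 n, ψ (α / k))
      atTop (𝓝 0) := by
    refine tendsto_of_tendsto_of_tendsto_of_le_of_le' tendsto_const_nhds hbound ?_ ?_
    · exact Eventually.of_forall fun n => mul_nonneg (by positivity)
        (Finset.sum_nonneg fun k _ => hψ_nonneg _ (by positivity))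
    · filter_upwards [eventually_ge_atTop 1] with n hn
      have hn1 : (1 : ℝ) ≤ n := by exact_mod_cast hn
      have hsum : ∑ k ∈ Finset.Icc 1 n, ψ (α / k) =
          ∑ k ∈ Finset.range n, ψ (α / (k + 1 : ℕ)) := by
        rw [Finset.range_eq_Ico, Finset.sum_Ico_add' (fun k : ℕ => ψ (α / k)) 0 n 1]
        rfl
      rw [hsum, ← mul_assoc, Real.div_rpow hα0 (by linarith), div_eq_mul_inv]
      have hle : (n : ℝ) ≤ (n : ℝ) ^ α := Real.self_le_rpow_of_one_le hn1 hα
      have : 0 ≤ ∑ k ∈ Finset.range n, ψ (α / (k + 1 : ℕ)) :=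
        Finset.sum_nonneg fun k _ => hψ_nonneg _ (by positivity)
      gcongr
  simpa [mul_assoc] using hmain.const_mul K

/-- Orbits of the base point under a map with Pata's contraction property are bounded. -/
theorem exists_dist_iterate_le {X : Type*} [PseudoMetricSpace X] {x₀ : X} {f : X → X} {ψ : ℝ → ℝ}
    (hψ_nonneg : ∀ t, 0 ≤ t → 0 ≤ ψ t)
    (hψ_cont : ContinuousWithinAt ψ (Set.Ici 0) 0) (hψ0 : ψ 0 = 0)
    {Λ α β : ℝ} (hΛ : 0 ≤ Λ) (hα : 1 ≤ α) (hβ : β ≤ α) (hnonexp : LipschitzWith 1 f)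
    (hf : ∀ ε ∈ Set.Icc (0 : ℝ) 1, ∀ x y : X,
      dist (f x) (f y) ≤ (1 - ε) * dist x y +
        Λ * ε ^ α * ψ ε * (1 + dist x x₀ + dist y x₀) ^ β) :
    ∃ M : ℝ, ∀ n, dist (f^[n] x₀) x₀ ≤ M := by
  have hα0 : 0 ≤ α := by linarith
  set b : ℝ := 2 * dist (f x₀) x₀ with hb
  have hb0 : 0 ≤ b := by positivity
  have hsmall : ∀ᶠ ε in 𝓝[Set.Ici 0] (0 : ℝ), Λ * (2 * (1 + b)) ^ α * ψ ε < 1 := by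
    have : Tendsto (fun ε => Λ * (2 * (1 + b)) ^ α * ψ ε) (𝓝[Set.Ici 0] 0) (𝓝 0) := by
      simpa [ContinuousWithinAt, hψ0] using hψ_cont.tendsto.const_mul (Λ * (2 * (1 + b)) ^ α)
    exact this.eventually_lt_const one_pos
  obtain ⟨δ, hδ, hδψ⟩ := Metric.mem_nhdsWithin_iff.1 hsmall
  refine ⟨max (1 + b) ((1 + b) / δ), fun n => ?_⟩
  by_contra! hlt
  set c := dist (f^[n] x₀) x₀ with hc
  have hc1 : 1 + b < c := (le_max_left _ _).trans_lt hlt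
  have hc2 : (1 + b) / δ < c := (le_max_right _ _).trans_lt hlt
  have hc0 : 0 < c := by linarith
  set ε := (1 + b) / c with hε
  have hε0 : 0 ≤ ε := by positivity
  have hε1 : ε ≤ 1 := (div_le_one hc0).2 hc1.le
  have hεδ : ε < δ := by
    rw [div_lt_iff₀ hδ] at hc2
    rw [hε, div_lt_iff₀ hc0]; linarith
  have hεc : ε * c = 1 + b := div_mul_cancel₀ _ hc0.ne'
  have hψε : Λ * (2 * (1 + b)) ^ α * ψ ε < 1 :=
    hδψ ⟨by simpa [abs_of_nonneg hε0] using hεδ, hε0⟩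
  have hstep : dist (f^[n] x₀) (f (f^[n] x₀)) ≤ dist (f x₀) x₀ := by
    have := (hnonexp.iterate n).dist_le_mul x₀ (f x₀)
    rw [← Function.iterate_succ_apply, Function.iterate_succ_apply'] at this
    simpa [dist_comm] using this
  have hcontr := hf ε ⟨hε0, hε1⟩ (f^[n] x₀) x₀
  rw [dist_self, add_zero, ← hc] at hcontr
  have htri := dist_triangle4 (f^[n] x₀) (f (f^[n] x₀)) (f x₀) x₀
  have herr : Λ * ε ^ α * ψ ε * (1 + c) ^ β ≤ Λ * (2 * (1 + b)) ^ α * ψ ε := by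
    have hpow : (1 + c) ^ β ≤ (2 * c) ^ α :=
      (Real.rpow_le_rpow_of_exponent_le (by linarith) hβ).trans
        (Real.rpow_le_rpow (by linarith) (by linarith) hα0)
    have := hψ_nonneg ε hε0
    calc Λ * ε ^ α * ψ ε * (1 + c) ^ β ≤ Λ * ε ^ α * ψ ε * (2 * c) ^ α := by gcongr
      _ = Λ * (ε ^ α * (2 * c) ^ α) * ψ ε := by ring
      _ = Λ * (2 * (1 + b)) ^ α * ψ ε := by
        rw [← Real.mul_rpow hε0 (by positivity), ← hεc, mul_left_comm]
  linarith


/-- Pata's fixed point theorem (Theorem 1 of Pata's paper). -/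
theorem pata_fixed_point {X : Type*} [MetricSpace X] [CompleteSpace X]
    (x₀ : X) (f : X → X) (ψ : ℝ → ℝ)
    (hψ_nonneg : ∀ t, 0 ≤ t → 0 ≤ ψ t)
    (hψ_mono : MonotoneOn ψ (Set.Ici 0))
    (hψ_cont : ContinuousWithinAt ψ (Set.Ici 0) 0)
    (hψ0 : ψ 0 = 0)
    (Λ α β : ℝ) (hΛ : 0 ≤ Λ) (hα : 1 ≤ α) (hβ : β ∈ Set.Icc 0 α)
    (hf : ∀ ε ∈ Set.Icc (0 : ℝ) 1, ∀ x y : X,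
      dist (f x) (f y) ≤ (1 - ε) * dist x y +
        Λ * ε ^ α * ψ ε * (1 + dist x x₀ + dist y x₀) ^ β) :
    ∃ xs : X, f xs = xs ∧ (∀ y : X, f y = y → y = xs) ∧
      ∃ C : ℝ, 0 ≤ C ∧ C ≤ Λ * (1 + 4 * dist xs x₀) ^ β ∧
        ∀ n : ℕ, 1 ≤ n →
          dist xs (f^[n] x₀) ≤
            C * (α / n) ^ α * ∑ k ∈ Finset.Icc 1 n, ψ (α / k) := by
  have hα0 : 0 < α := by linarith
  have hnonexp : LipschitzWith 1 f := LipschitzWith.mk_one fun x y => by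
    simpa [Real.zero_rpow hα0.ne'] using hf 0 (by simp) x y
  have error_le : ∀ {x y : X} {R : ℝ}, dist x x₀ + dist y x₀ ≤ R → ∀ ε ∈ Set.Icc (0 : ℝ) 1,
      dist (f x) (f y) ≤ (1 - ε) * dist x y + Λ * (1 + R) ^ β * ε ^ α * ψ ε := by
    intro x y R hR ε hε
    have hpow : (1 + dist x x₀ + dist y x₀) ^ β ≤ (1 + R) ^ β :=
      Real.rpow_le_rpow (by positivity) (by linarith) hβ.1
    have : 0 ≤ Λ * ε ^ α * ψ ε :=
      mul_nonneg (mul_nonneg hΛ (Real.rpow_nonneg hε.1 α)) (hψ_nonneg ε hε.1)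
    linarith [hf ε hε x y, mul_le_mul_of_nonneg_left hpow this]
  obtain ⟨M, hM⟩ := exists_dist_iterate_le hψ_nonneg hψ_cont hψ0 hΛ hα hβ.2 hnonexp hf
  have hM0 : 0 ≤ M := dist_nonneg.trans (hM 0)
  have hcauchy : CauchySeq fun n => f^[n] x₀ := by
    have hlim := tendsto_rpow_mul_sum hψ_nonneg hψ_cont hψ0 hα (Λ * (1 + (M + M)) ^ β)
    -- index `0` is excluded from the bound, so the orbit is shifted by one
    refine (cauchySeq_shift 1).1 (cauchySeq_of_le_tendsto_0' _ (fun n m hnm => ?_)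
      ((tendsto_add_atTop_iff_nat 1).2 hlim))
    obtain ⟨k, rfl⟩ := Nat.exists_eq_add_of_le hnm
    have hle := le_mul_sum_of_contraction_error
      (a := fun n => dist (f^[n] x₀) (f^[n + k] x₀)) hψ_nonneg hψ_mono hα
      (K := Λ * (1 + (M + M)) ^ β) (by positivity) (fun ε hε n => ?_) (Nat.le_add_left 1 n)
    · simpa only [Nat.add_right_comm n k 1] using hle
    · simpa only [Nat.add_right_comm n 1 k, Function.iterate_succ_apply'] using
        error_le (add_le_add (hM n) (hM (n + k))) ε hε
  obtain ⟨xs, hxs⟩ := cauchySeq_tendsto_of_complete hcauchy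
  have hfix : f xs = xs := isFixedPt_of_tendsto_iterate hxs hnonexp.continuous.continuousAt
  refine ⟨xs, hfix, fun y hy => ?_, Λ * (1 + 4 * dist xs x₀) ^ β, by positivity, le_rfl,
    fun n hn => ?_⟩
  · have hlim := tendsto_rpow_mul_sum hψ_nonneg hψ_cont hψ0 hα
      (Λ * (1 + (dist y x₀ + dist xs x₀)) ^ β)
    refine dist_le_zero.1 (ge_of_tendsto hlim ?_)
    filter_upwards [eventually_ge_atTop 1] with n hn
    refine le_mul_sum_of_contraction_error (a := fun _ => dist y xs) hψ_nonneg hψ_mono hα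
      (by positivity) (fun ε hε _ => ?_) hn
    simpa only [hy, hfix] using error_le (x := y) (y := xs) le_rfl ε hε
  · refine le_mul_sum_of_contraction_error (a := fun n => dist xs (f^[n] x₀)) hψ_nonneg hψ_mono hα
      (by positivity) (fun ε hε n => ?_) hn
    have horbit : dist xs (f^[n] x₀) ≤ dist xs x₀ := by
      simpa [Function.iterate_fixed hfix] using (hnonexp.iterate n).dist_le_mul xs x₀
    have hnorm : dist xs x₀ + dist (f^[n] x₀) x₀ ≤ 4 * dist xs x₀ := by
      linarith [dist_triangle_left (f^[n] x₀) x₀ xs, dist_nonneg (x := xs) (y := x₀)]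
    simpa only [hfix, Function.iterate_succ_apply'] using error_le hnorm ε hε
end

section
/- Let (X,d) be a metric space, let x₀ ∈ X be a fixed base point and write ‖x‖ := d(x,x₀) for x ∈ X. Let f : X → X, let ψ : [0,∞) → [0,∞) be increasing, continuous at 0 with ψ(0) = 0, and let Λ ≥ 0, α ≥ 1 and β ∈ [0,α] be fixed constants. If for every ε ∈ [0,1] and all x,y ∈ X one has d(f(x),f(y)) ≤ (1-ε)·d(x,y) + Λ·ε^α·ψ(ε)·(1 + ‖x‖ + ‖y‖)^β, then f has at most one fixed point: if f(x) = x and f(y) = y then x = y. -/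
/-- Uniqueness part of Pata's fixed point theorem (no completeness needed). -/
theorem pata_fixed_point_unique {X : Type*} [MetricSpace X]
    (x₀ : X) (f : X → X) (ψ : ℝ → ℝ)
    (hψ_nonneg : ∀ t, 0 ≤ t → 0 ≤ ψ t)
    (hψ_mono : MonotoneOn ψ (Set.Ici 0))
    (hψ_cont : ContinuousWithinAt ψ (Set.Ici 0) 0)
    (hψ0 : ψ 0 = 0)
    (Λ α β : ℝ) (hΛ : 0 ≤ Λ) (hα : 1 ≤ α) (hβ : β ∈ Set.Icc 0 α)
    (hf : ∀ ε ∈ Set.Icc (0 : ℝ) 1, ∀ x y : X,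
      dist (f x) (f y) ≤ (1 - ε) * dist x y +
        Λ * ε ^ α * ψ ε * (1 + dist x x₀ + dist y x₀) ^ β) :
    ∀ x y : X, f x = x → f y = y → x = y := by
  intro x y hx hy
  set C := (1 + dist x x₀ + dist y x₀) ^ β
  have hC : 0 ≤ C := by positivity
  have hbound : ∀ ε ∈ Set.Ioc (0 : ℝ) 1, dist x y ≤ Λ * C * ψ ε := by
    intro ε hε
    have hpow : ε ^ α ≤ ε := by
      simpa using Real.rpow_le_rpow_of_exponent_ge hε.1 hε.2 hα
    have hcontr := hf ε ⟨hε.1.le, hε.2⟩ x y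
    rw [hx, hy] at hcontr
    have hnonneg : 0 ≤ Λ * C * ψ ε := mul_nonneg (mul_nonneg hΛ hC) (hψ_nonneg ε hε.1.le)
    have hmul : ε ^ α * (Λ * C * ψ ε) ≤ ε * (Λ * C * ψ ε) :=
      mul_le_mul_of_nonneg_right hpow hnonneg
    refine le_of_mul_le_mul_left ?_ hε.1
    linarith
  have hlim : Filter.Tendsto (fun ε => Λ * C * ψ ε) (nhdsWithin 0 (Set.Ioi 0)) (nhds 0) := by
    have h := (hψ_cont.mono Set.Ioi_subset_Ici_self).tendsto.const_mul (Λ * C)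
    rwa [hψ0, mul_zero] at h
  exact dist_le_zero.mp <| ge_of_tendsto hlim <|
    Filter.mem_of_superset (Ioc_mem_nhdsGT one_pos) hbound
end

section
/- Let ψ : [0,∞) → [0,∞) be increasing, continuous at 0 with ψ(0) = 0, and let α ≥ 1. Then the sequence ωₙ(α) := (α/n)^α·∑_{k=1}^{n} ψ(α/k) converges to 0 as n → ∞. -/
/-- The rate sequence ωₙ(α) := (α/n)^α · ∑_{k=1}^{n} ψ(α/k) vanishes as n → ∞. -/
theorem omega_tendsto_zero (ψ : ℝ → ℝ)
    (hψ_nonneg : ∀ t, 0 ≤ t → 0 ≤ ψ t)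
    (hψ_mono : MonotoneOn ψ (Set.Ici 0))
    (hψ_cont : ContinuousWithinAt ψ (Set.Ici 0) 0)
    (hψ0 : ψ 0 = 0)
    (α : ℝ) (hα : 1 ≤ α) :
    Filter.Tendsto
      (fun n : ℕ => (α / n) ^ α * ∑ k ∈ Finset.Icc 1 n, ψ (α / k))
      Filter.atTop (nhds 0) := by
  have hu : Filter.Tendsto (fun i : ℕ => ψ (α / (i + 1 : ℕ))) Filter.atTop (nhds 0) := by
    have hlim : Filter.Tendsto (fun i : ℕ => α / (i + 1 : ℕ)) Filter.atTop
        (nhdsWithin 0 (Set.Ici 0)) :=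
      tendsto_nhdsWithin_iff.2
        ⟨(tendsto_const_div_atTop_nhds_zero_nat α).comp (Filter.tendsto_add_atTop_nat 1),
          Filter.Eventually.of_forall fun i => Set.mem_Ici.2 (by positivity)⟩
    simpa only [hψ0, Function.comp_def] using hψ_cont.tendsto.comp hlim
  have hsum (n : ℕ) : ∑ k ∈ Finset.Icc 1 n, ψ (α / k) =
      ∑ i ∈ Finset.range n, ψ (α / (i + 1 : ℕ)) := by
    induction n with
    | zero => simp
    | succ n ih => rw [Finset.sum_Icc_succ_top (by omega), ih, Finset.sum_range_succ]
  have hnonneg (n : ℕ) : 0 ≤ ∑ i ∈ Finset.range n, ψ (α / (i + 1 : ℕ)) :=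
    Finset.sum_nonneg fun i _ => hψ_nonneg _ (by positivity)
  have hbound := hu.cesaro.const_mul (α ^ α)
  rw [mul_zero] at hbound
  refine tendsto_of_tendsto_of_tendsto_of_le_of_le' tendsto_const_nhds hbound ?_ ?_
  · refine Filter.Eventually.of_forall fun n => ?_
    rw [hsum]
    exact mul_nonneg (by positivity) (hnonneg n)
  · filter_upwards [Filter.eventually_ge_atTop 1] with n hn
    have hn' : (1 : ℝ) ≤ n := by exact_mod_cast hn
    rw [hsum, ← mul_assoc, Real.div_rpow (by positivity) (by positivity), div_eq_mul_inv]
    refine mul_le_mul_of_nonneg_right (mul_le_mul_of_nonneg_left ?_ (by positivity)) (hnonneg n)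
    exact inv_anti₀ (by positivity) (Real.self_le_rpow_of_one_le hn' hα)
end

section
/- Berinde's Theorem 1.1 is false. Concretely, take X := ℝ with its usual metric, f : ℝ → ℝ given by f(x) := x/2, base point x₀ := 1 with ‖x‖ := |x - x₀|, and the constants Λ := 1/2, α := 1, ψ(ε) := ε, β := 0. Then for every ε ∈ [0,1] and all x,y ∈ ℝ one has |f(x) - f(y)| ≤ (1-ε)·|x-y| + Λ·ε^α·ψ(ε)·(1 + ‖x‖ + ‖y‖), yet there exists no pair (x*, C) with f(x*) = x*, 0 ≤ C ≤ Λ·(1 + 4‖x*‖)·β, and |x* - fⁿ(x₀)| ≤ C·(α/n)·∑_{k=1}^{n} ψ(α/k) for all n ≥ 1. -/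
/-- Berinde's Theorem 1.1 is false: the map f(x) = x/2 on ℝ, with base point
x₀ := 1, Λ := 1/2, α := 1, ψ(ε) := ε, β := 0, satisfies its hypothesis but
not its conclusion. -/
theorem berinde_thm_1_1_false :
    (∀ ε ∈ Set.Icc (0 : ℝ) 1, ∀ x y : ℝ,
      |(x / 2) - (y / 2)| ≤ (1 - ε) * |x - y| +
        (1 / 2) * ε ^ (1 : ℝ) * ε * (1 + |x - 1| + |y - 1|)) ∧
    ¬ ∃ (xs C : ℝ), (xs / 2 = xs) ∧ 0 ≤ C ∧
        C ≤ (1 / 2) * (1 + 4 * |xs - 1|) * 0 ∧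
        ∀ n : ℕ, 1 ≤ n →
          |xs - (fun x : ℝ => x / 2)^[n] 1| ≤
            C * ((1 : ℝ) / n) * ∑ k ∈ Finset.Icc 1 n, ((1 : ℝ) / k) := by
  constructor
  · rintro ε - x y
    have htri : |x - y| ≤ |x - 1| + |y - 1| := by
      simpa [abs_sub_comm 1 y] using abs_sub_le x 1 y
    have hhalf : |x / 2 - y / 2| = |x - y| / 2 := by
      rw [← sub_div, abs_div, abs_two]
    rw [hhalf, Real.rpow_one]
    have hmul := mul_le_mul_of_nonneg_left htri (sq_nonneg ε)
    have hsq := mul_nonneg (sq_nonneg (1 - ε)) (abs_nonneg (x - y))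
    nlinarith [sq_nonneg ε]
  · rintro ⟨xs, C, hfix, hC, hCle, hbound⟩
    have hxs : xs = 0 := by linarith
    have hC0 : C = 0 := le_antisymm (by simpa using hCle) hC
    have h := hbound 1 le_rfl
    norm_num [hxs, hC0] at h
end

section
/- Let X := {-1, 1} ⊆ ℝ with the metric induced from ℝ, let f : X → X be given by f(x) := -x, and let x₀ := 1 with ‖x‖ := |x - x₀|. Then for every fixed ε ∈ [0,1] there exist a constant Λ ≥ 0, a constant α ≥ 1, and an increasing function ψ : [0,∞) → [0,∞) continuous at 0 with ψ(0) = 0, such that |f(x) - f(y)| ≤ (1-ε)·|x-y| + Λ·ε^α·ψ(ε)·(1 + ‖x‖ + ‖y‖) for all x,y ∈ X; yet f has no fixed point. -/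
/-- The two-point space X = {-1, 1} ⊆ ℝ. -/
def PataX : Set ℝ := {-1, 1}

/-- The map f(x) = -x on {-1, 1}. -/
def PataF : PataX → PataX := fun x =>
  ⟨-x.1, by have h := x.2; simp only [PataX, Set.mem_insert_iff, Set.mem_singleton_iff] at h ⊢; rcases h with h | h <;> simp [h]⟩

/-- The base point x₀ = 1 of {-1, 1}. -/
def PataBase : PataX := ⟨1, by simp [PataX]⟩

theorem dist_pataF (x y : PataX) : dist (PataF x) (PataF y) = dist x y :=
  dist_neg_neg x.1 y.1

theorem pataF_ne_self (x : PataX) : PataF x ≠ x := by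
  obtain ⟨x, rfl | rfl⟩ := x <;> norm_num [PataF, Subtype.ext_iff]

/-- For every fixed ε ∈ [0,1] there are Λ, α, ψ making the single-ε Pata-type
inequality hold on X = {-1,1} for f(x) = -x, yet f has no fixed point. -/
theorem single_epsilon_pata_condition_no_fixed_point :
    (∀ ε ∈ Set.Icc (0 : ℝ) 1,
      ∃ (Λ α : ℝ) (ψ : ℝ → ℝ), 0 ≤ Λ ∧ 1 ≤ α ∧
        (∀ t, 0 ≤ t → 0 ≤ ψ t) ∧ MonotoneOn ψ (Set.Ici 0) ∧
        ContinuousWithinAt ψ (Set.Ici 0) 0 ∧ ψ 0 = 0 ∧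
        ∀ x y : PataX,
          dist (PataF x) (PataF y) ≤ (1 - ε) * dist x y +
            Λ * ε ^ α * ψ ε * (1 + dist x PataBase + dist y PataBase)) ∧
    ¬ ∃ x : PataX, PataF x = x := by
  refine ⟨fun ε hε => ⟨ε⁻¹, 1, id, inv_nonneg.2 hε.1, le_rfl, fun _ ht => ht,
    monotone_id.monotoneOn _, continuous_id.continuousWithinAt, rfl, fun x y => ?_⟩,
    fun ⟨x, hx⟩ => pataF_ne_self x hx⟩
  have htri : dist x y ≤ 1 + dist x PataBase + dist y PataBase := by
    linarith [dist_triangle_right x y PataBase]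
  have hcoef : ε⁻¹ * ε ^ (1 : ℝ) * id ε = ε := by
    rw [Real.rpow_one, id, inv_mul_mul_self]
  rw [dist_pataF, hcoef]
  linarith [mul_le_mul_of_nonneg_left htri hε.1]
end
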